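/- Let K be an algebraically closed field and let f_1,…,f_m ∈ K[x_1,…,x_m] have total degrees d_1,…,d_m ≥ 1. Assume that the leading forms of f_1,…,f_m (the homogeneous components of degrees d_1,…,d_m respectively) have no common zero in K^m other than the origin. Then the quotient algebra A = K[x_1,…,x_m]/⟨f_1,…,f_m⟩ is a finite-dimensional K-vector space of dimension exactly Π_{i=1}^m d_i. -/

import Mathlib

open MvPolynomial

section Depth

variable {R : Type*} [CommRing R]

/-- `z` is a non-zero-divisor on `R ⧸ J`. -/
def NzdMod (J : Ideal R) (z : R) : Prop := ∀ a, z * a ∈ J → a ∈ J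

/-- The ideal `P` contains a weakly regular sequence of length `n` on `R ⧸ J`. -/
def HasDepth (P : Ideal R) : ℕ → Ideal R → Prop
  | 0, _ => True
  | n + 1, J => ∃ z ∈ P, NzdMod J z ∧ HasDepth P n (J ⊔ Ideal.span {z})

lemma mem_sup_span_singleton {J : Ideal R} {z a : R} :
    a ∈ J ⊔ Ideal.span {z} ↔ ∃ b, a - z * b ∈ J := by
  rw [sup_comm, Ideal.mem_span_singleton_sup]
  constructor
  · rintro ⟨b, j, hj, rfl⟩
    exact ⟨b, by simpa [mul_comm] using hj⟩
  · rintro ⟨b, hb⟩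
    exact ⟨b, _, hb, by ring⟩

lemma exists_finite_primes_of_nzdMod [IsNoetherianRing R] (J : Ideal R) :
    ∃ S : Set (Ideal R), S.Finite ∧ (∀ Q ∈ S, Q.IsPrime) ∧
      (∀ Q ∈ S, ∃ u ∉ J, ∀ q ∈ Q, q * u ∈ J) ∧ ∀ z, (∀ Q ∈ S, z ∉ Q) → NzdMod J z := by
  refine ⟨associatedPrimes R (R ⧸ J), associatedPrimes.finite R _,
    fun Q hQ => IsAssociatedPrime.isPrime hQ, fun Q hQ => ?_, fun z hz a ha => ?_⟩
  · obtain ⟨-, x, rfl⟩ := isAssociatedPrime_iff.mp hQ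
    obtain ⟨u, rfl⟩ := Ideal.Quotient.mk_surjective x
    refine ⟨u, fun hu => ?_, fun q hq => ?_⟩
    · have := (IsAssociatedPrime.isPrime hQ).ne_top
      simp [Ideal.Quotient.eq_zero_iff_mem.mpr hu] at this
    · rw [Submodule.mem_colon_singleton] at hq
      rw [← Ideal.Quotient.eq_zero_iff_mem]
      simpa [Algebra.smul_def] using hq
  · by_contra hna
    have : z ∈ ⋃ p ∈ associatedPrimes R (R ⧸ J), (p : Set R) := by
      rw [biUnion_associatedPrimes_eq_zero_divisors]
      refine ⟨Ideal.Quotient.mk J a, by rwa [Ne, Ideal.Quotient.eq_zero_iff_mem], ?_⟩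
      rw [← Ideal.Quotient.eq_zero_iff_mem, map_mul] at ha
      simpa [Algebra.smul_def] using ha
    simp only [Set.mem_iUnion] at this
    obtain ⟨Q, hQ, hzQ⟩ := this
    exact hz Q hQ hzQ

lemma NzdMod.swap {J : Ideal R} {w y : R} (hw : NzdMod J w)
    (hy : NzdMod (J ⊔ Ideal.span {w}) y) : NzdMod (J ⊔ Ideal.span {y}) w := by
  intro a ha
  obtain ⟨b, hb⟩ := mem_sup_span_singleton.mp ha
  obtain ⟨c, hc⟩ := mem_sup_span_singleton.mp
    (hy b (mem_sup_span_singleton.mpr ⟨a, by simpa using J.neg_mem hb⟩))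
  refine mem_sup_span_singleton.mpr ⟨c, hw _ ?_⟩
  have := J.add_mem hb (J.mul_mem_left y hc)
  ring_nf at this ⊢
  exact this

/-- A socle element of `R ⧸ (J, z)` yields one of `R ⧸ (J, w)`. -/
lemma NzdMod.exists_socle {P J : Ideal R} {w z : R} (hwP : w ∈ P) (hw : NzdMod J w)
    (hz : NzdMod J z) {u : R} (hu : u ∉ J ⊔ Ideal.span {z})
    (hPu : ∀ p ∈ P, p * u ∈ J ⊔ Ideal.span {z}) :
    ∃ v ∉ J ⊔ Ideal.span {w}, ∀ p ∈ P, p * v ∈ J ⊔ Ideal.span {w} := by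
  obtain ⟨v, hv⟩ := mem_sup_span_singleton.mp (hPu w hwP)
  refine ⟨v, fun hvw => hu ?_, fun p hp => ?_⟩
  · obtain ⟨c, hc⟩ := mem_sup_span_singleton.mp hvw
    refine mem_sup_span_singleton.mpr ⟨c, hw _ ?_⟩
    have := J.add_mem hv (J.mul_mem_left z hc)
    ring_nf at this ⊢
    exact this
  · obtain ⟨c, hc⟩ := mem_sup_span_singleton.mp (hPu p hp)
    refine mem_sup_span_singleton.mpr ⟨c, hz _ ?_⟩
    have := J.sub_mem (J.mul_mem_left w hc) (J.mul_mem_left p hv)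
    ring_nf at this ⊢
    exact this

/-- Prime avoidance: if no associated prime of the listed quotients contains `P`, then `P` contains
an element which is a non-zero-divisor on all of them. -/
lemma exists_mem_nzdMod [IsNoetherianRing R] (P : Ideal R) (T : Set (Ideal R)) (hT : T.Finite)
    (h : ∀ J ∈ T, ∀ u, (∀ p ∈ P, p * u ∈ J) → u ∈ J) : ∃ y ∈ P, ∀ J ∈ T, NzdMod J y := by
  choose S hfin hprime hann hnzd using exists_finite_primes_of_nzdMod (R := R)
  have hU : (⋃ J ∈ T, S J).Finite := hT.biUnion fun J _ => hfin J
  by_contra! hcon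
  have hsub : (P : Set R) ⊆ ⋃ Q ∈ (hU.toFinset : Set (Ideal R)), (id Q : Ideal R) := by
    intro y hy
    obtain ⟨J, hJ, hyJ⟩ := hcon y hy
    have : ¬ ∀ Q ∈ S J, y ∉ Q := fun h' => hyJ (hnzd J y h')
    push Not at this
    obtain ⟨Q, hQ, hyQ⟩ := this
    simp only [Set.Finite.coe_toFinset, Set.mem_iUnion, id]
    exact ⟨Q, ⟨J, hJ, hQ⟩, hyQ⟩
  rw [Ideal.subset_union_prime ⊤ ⊤] at hsub
  · obtain ⟨Q, hQ, hPQ⟩ := hsub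
    simp only [Set.Finite.mem_toFinset, Set.mem_iUnion] at hQ
    obtain ⟨J, hJ, hQ⟩ := hQ
    obtain ⟨u, hu, hQu⟩ := hann J Q hQ
    exact hu (h J hJ u fun p hp => hQu p (hPQ hp))
  · intro Q hQ _ _
    simp only [Set.Finite.mem_toFinset, Set.mem_iUnion] at hQ
    obtain ⟨J, hJ, hQ⟩ := hQ
    exact hprime J Q hQ

/-- Cutting by any non-zero-divisor of `P` lowers the depth by at most one. -/
lemma HasDepth.sup_span_singleton [IsNoetherianRing R] {P : Ideal R} (n : ℕ) :
    ∀ {J : Ideal R} {z : R}, HasDepth P (n + 1) J → z ∈ P → NzdMod J z →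
      HasDepth P n (J ⊔ Ideal.span {z}) := by
  induction n with
  | zero => intros; trivial
  | succ n ih =>
    rintro J z ⟨w, hwP, hw, hdep⟩ hzP hz
    obtain ⟨w', hw'P, hw', -⟩ := id hdep
    have hsoc : ∀ u, (∀ p ∈ P, p * u ∈ J ⊔ Ideal.span {w}) → u ∈ J ⊔ Ideal.span {w} :=
      fun u hu => hw' u (hu w' hw'P)
    obtain ⟨y, hyP, hy⟩ := exists_mem_nzdMod P {J, J ⊔ Ideal.span {w}, J ⊔ Ideal.span {z}}
      (by simp) (by
        rintro K (rfl | rfl | rfl) u hu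
        · exact hw u (hu w hwP)
        · exact hsoc u hu
        · by_contra hu'
          obtain ⟨v, hv, hPv⟩ := hw.exists_socle hwP hz hu' hu
          exact hv (hsoc v hPv))
    have hyJ : NzdMod J y := hy _ (by simp)
    have hyw : NzdMod (J ⊔ Ideal.span {w}) y := hy _ (by simp)
    have hyz : NzdMod (J ⊔ Ideal.span {z}) y := hy _ (by simp)
    have h1 : HasDepth P (n + 1) (J ⊔ Ideal.span {y}) :=
      ⟨w, hwP, hw.swap hyw, by simpa only [sup_right_comm] using ih hdep hyP hyw⟩
    exact ⟨y, hyP, hyz, by simpa only [sup_right_comm] using ih h1 hzP (hz.swap hyz)⟩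

end Depth

section Filtration

variable {σ K : Type*} [Field K]

/-- The polynomials of total degree less than `n`. -/
noncomputable def degreeBelow (σ K : Type*) [Field K] (n : ℕ) : Submodule K (MvPolynomial σ K) :=
  restrictSupport K {s | s.degree < n}

lemma mem_degreeBelow {n : ℕ} {p : MvPolynomial σ K} :
    p ∈ degreeBelow σ K n ↔ ∀ s ∈ p.support, s.degree < n := by
  rw [degreeBelow, mem_restrictSupport_iff]
  rfl

lemma degreeBelow_mono {m n : ℕ} (h : m ≤ n) : degreeBelow σ K m ≤ degreeBelow σ K n :=
  restrictSupport_mono _ fun _ hs => lt_of_lt_of_le hs h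

lemma degreeBelow_zero : degreeBelow σ K 0 = ⊥ := by
  rw [eq_bot_iff]
  intro p hp
  rw [mem_degreeBelow] at hp
  rw [Submodule.mem_bot, ← support_eq_empty, Finset.eq_empty_iff_forall_notMem]
  exact fun s hs => absurd (hp s hs) (by simp)

lemma mem_degreeBelow_succ_iff {n : ℕ} {p : MvPolynomial σ K} :
    p ∈ degreeBelow σ K (n + 1) ↔ p.totalDegree ≤ n := by
  rw [mem_degreeBelow, totalDegree, Finset.sup_le_iff]
  simp only [Nat.lt_succ_iff]
  rfl

lemma exists_mem_degreeBelow (p : MvPolynomial σ K) : ∃ n, p ∈ degreeBelow σ K n :=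
  ⟨_, mem_degreeBelow_succ_iff.mpr le_rfl⟩

instance [Finite σ] (n : ℕ) : Module.Finite K (degreeBelow σ K n) := by
  cases n with
  | zero => rw [degreeBelow_zero]; infer_instance
  | succ n =>
    have : degreeBelow σ K (n + 1) = restrictTotalDegree σ K n := by
      ext p
      rw [mem_degreeBelow_succ_iff, mem_restrictTotalDegree]
    rw [this]
    infer_instance

lemma homogeneousComponent_of_mem_degreeBelow {m n : ℕ} (h : n ≤ m) {p : MvPolynomial σ K}
    (hp : p ∈ degreeBelow σ K n) : homogeneousComponent m p = 0 :=
  homogeneousComponent_eq_zero' _ _ fun s hs => ((mem_degreeBelow.mp hp s hs).trans_le h).ne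

lemma mem_degreeBelow_of_homogeneousComponent_eq_zero {n : ℕ} {p : MvPolynomial σ K}
    (hp : p ∈ degreeBelow σ K (n + 1)) (h : homogeneousComponent n p = 0) :
    p ∈ degreeBelow σ K n := by
  rw [mem_degreeBelow] at hp ⊢
  intro s hs
  refine lt_of_le_of_ne (Nat.lt_succ_iff.mp (hp s hs)) fun hsn => ?_
  have := coeff_homogeneousComponent n p s
  rw [h, if_pos hsn, coeff_zero] at this
  exact mem_support_iff.mp hs this.symm

lemma MvPolynomial.IsHomogeneous.mem_degreeBelow {n : ℕ} {p : MvPolynomial σ K}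
    (hp : p.IsHomogeneous n) : p ∈ degreeBelow σ K (n + 1) :=
  mem_degreeBelow_succ_iff.mpr hp.totalDegree_le

lemma sub_homogeneousComponent_mem_degreeBelow {n : ℕ} {p : MvPolynomial σ K}
    (hp : p ∈ degreeBelow σ K (n + 1)) : p - homogeneousComponent n p ∈ degreeBelow σ K n := by
  have hc := homogeneousComponent_isHomogeneous n p
  refine mem_degreeBelow_of_homogeneousComponent_eq_zero
    (Submodule.sub_mem _ hp hc.mem_degreeBelow) ?_
  rw [map_sub, homogeneousComponent_eq_self hc, sub_self]

lemma mul_mem_degreeBelow {m n : ℕ} {p q : MvPolynomial σ K} (hp : p ∈ degreeBelow σ K m)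
    (hq : q ∈ degreeBelow σ K (n + 1)) : p * q ∈ degreeBelow σ K (m + n) := by
  classical
  rw [mem_degreeBelow] at *
  intro s hs
  obtain ⟨a, ha, b, hb, rfl⟩ := Finset.mem_add.mp (support_mul p q hs)
  have := hp a ha
  have := hq b hb
  rw [map_add]
  omega

lemma homogeneousComponent_mul_of_mem_degreeBelow {m n : ℕ} {p q : MvPolynomial σ K}
    (hp : p ∈ degreeBelow σ K (m + 1)) (hq : q ∈ degreeBelow σ K (n + 1)) :
    homogeneousComponent (m + n) (p * q) = homogeneousComponent m p * homogeneousComponent n q := by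
  have hpc := homogeneousComponent_isHomogeneous m p
  have hqc := homogeneousComponent_isHomogeneous n q
  have h1 := mul_mem_degreeBelow (sub_homogeneousComponent_mem_degreeBelow hp) hq
  have h2 := mul_mem_degreeBelow (sub_homogeneousComponent_mem_degreeBelow hq) hpc.mem_degreeBelow
  have key : p * q = homogeneousComponent m p * homogeneousComponent n q +
      ((p - homogeneousComponent m p) * q +
        (q - homogeneousComponent n q) * homogeneousComponent m p) := by ring
  rw [key, map_add, map_add, homogeneousComponent_eq_self (hpc.mul hqc),
    homogeneousComponent_of_mem_degreeBelow le_rfl h1,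
    homogeneousComponent_of_mem_degreeBelow (add_comm n m).le h2, add_zero, add_zero]

lemma homogeneousComponent_mul_of_isHomogeneous {n d : ℕ} (p : MvPolynomial σ K)
    {q : MvPolynomial σ K} (hq : q.IsHomogeneous d) :
    homogeneousComponent n (p * q) =
      if d ≤ n then homogeneousComponent (n - d) p * q else 0 := by
  classical
  conv_lhs => rw [← sum_homogeneousComponent p, Finset.sum_mul, map_sum]
  have h : ∀ i, homogeneousComponent n (homogeneousComponent i p * q) =
      if n = i + d then homogeneousComponent i p * q else 0 := fun i =>
    homogeneousComponent_of_mem ((homogeneousComponent_isHomogeneous i p).mul hq)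
  simp_rw [h]
  split_ifs with hd
  · rw [Finset.sum_eq_single (n - d)]
    · rw [if_pos (by omega)]
    · intro i _ hi
      rw [if_neg (by omega)]
    · intro hi
      rw [homogeneousComponent_eq_zero _ _ (by simp at hi; omega), zero_mul, ite_self]
  · exact Finset.sum_eq_zero fun i _ => if_neg (by omega)

/-- `J` is the ideal of leading forms of elements of `L`. -/
structure IsInitialIdeal (L J : Ideal (MvPolynomial σ K)) : Prop where
  homogeneousComponent_mem : ∀ n, ∀ u ∈ L, u ∈ degreeBelow σ K (n + 1) →
    homogeneousComponent n u ∈ J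
  exists_lift : ∀ n, ∀ v ∈ J, ∃ u ∈ L, u ∈ degreeBelow σ K (n + 1) ∧
    homogeneousComponent n u = homogeneousComponent n v

lemma isInitialIdeal_bot : IsInitialIdeal (⊥ : Ideal (MvPolynomial σ K)) ⊥ where
  homogeneousComponent_mem := by
    rintro n u hu -
    rw [Ideal.mem_bot] at hu ⊢
    rw [hu, map_zero]
  exists_lift := by
    intro n v hv
    rw [Ideal.mem_bot] at hv
    exact ⟨0, Ideal.zero_mem _, Submodule.zero_mem _, by rw [hv]⟩

variable {L J : Ideal (MvPolynomial σ K)} {d : ℕ} {f : MvPolynomial σ K}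

/-- Multiplication by `f` on `MvPolynomial σ K ⧸ L` is strict for the degree filtration. -/
lemma IsInitialIdeal.exists_sub_mem (h : IsInitialIdeal L J) (hf : f ∈ degreeBelow σ K (d + 1))
    (hz : NzdMod J (homogeneousComponent d f)) {n : ℕ} {a l : MvPolynomial σ K} (hl : l ∈ L)
    (ha : a * f - l ∈ degreeBelow σ K (n + d)) : ∃ b ∈ degreeBelow σ K n, a - b ∈ L := by
  suffices H : ∀ j, ∀ a ∈ degreeBelow σ K (n + j), ∀ l ∈ L,
      a * f - l ∈ degreeBelow σ K (n + d) → ∃ b ∈ degreeBelow σ K n, a - b ∈ L by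
    obtain ⟨j, hj⟩ := exists_mem_degreeBelow a
    exact H j a (degreeBelow_mono (by omega) hj) l hl ha
  intro j
  induction j with
  | zero => exact fun a ha l _ _ => ⟨a, ha, by simp⟩
  | succ j ih =>
    intro a ha l hl hal
    have haf : a * f ∈ degreeBelow σ K (n + j + d + 1) := by
      convert mul_mem_degreeBelow ha hf using 2; omega
    have hl' : l ∈ degreeBelow σ K (n + j + d + 1) := by
      rw [← sub_sub_cancel (a * f) l]
      exact Submodule.sub_mem _ haf (degreeBelow_mono (by omega) hal)
    have hc := h.homogeneousComponent_mem _ l hl hl'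
    have hc' : homogeneousComponent (n + j + d) l = homogeneousComponent (n + j + d) (a * f) := by
      rw [eq_comm, ← sub_eq_zero, ← map_sub]
      exact homogeneousComponent_of_mem_degreeBelow (by omega) hal
    rw [hc', homogeneousComponent_mul_of_mem_degreeBelow (m := n + j) ha hf, mul_comm] at hc
    obtain ⟨u, huL, hu, hua⟩ := h.exists_lift (n + j) _ (hz _ hc)
    rw [homogeneousComponent_eq_self (homogeneousComponent_isHomogeneous _ _)] at hua
    obtain ⟨b, hb, hab⟩ := ih (a - u)
      (mem_degreeBelow_of_homogeneousComponent_eq_zero (Submodule.sub_mem _ ha hu)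
        (by rw [map_sub, hua, sub_self]))
      (l - u * f) (L.sub_mem hl (L.mul_mem_right _ huL)) (by convert hal using 1; ring)
    refine ⟨b, hb, ?_⟩
    convert L.add_mem hab huL using 1; ring

lemma IsInitialIdeal.mem_of_mul_mem (h : IsInitialIdeal L J) (hf : f ∈ degreeBelow σ K (d + 1))
    (hz : NzdMod J (homogeneousComponent d f)) {a : MvPolynomial σ K} {l : MvPolynomial σ K}
    (hl : l ∈ L) (ha : a * f - l ∈ degreeBelow σ K d) : a ∈ L := by
  obtain ⟨b, hb, hab⟩ := h.exists_sub_mem hf hz (n := 0) hl (by simpa using ha)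
  rw [degreeBelow_zero, Submodule.mem_bot] at hb
  simpa [hb] using hab

lemma IsInitialIdeal.sup_span_singleton (h : IsInitialIdeal L J)
    (hf : f ∈ degreeBelow σ K (d + 1)) (hz : NzdMod J (homogeneousComponent d f)) :
    IsInitialIdeal (L ⊔ Ideal.span {f}) (J ⊔ Ideal.span {homogeneousComponent d f}) where
  homogeneousComponent_mem := by
    intro n u hu hun
    obtain ⟨a, hau⟩ := mem_sup_span_singleton.mp hu
    obtain hd | hd := lt_or_ge n d
    · have : a ∈ L := h.mem_of_mul_mem hf hz (l := -(u - f * a)) (L.neg_mem hau)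
        (by convert degreeBelow_mono hd hun using 1; ring)
      refine Ideal.mem_sup_left (h.homogeneousComponent_mem n u ?_ hun)
      simpa using L.add_mem hau (L.mul_mem_left f this)
    · obtain ⟨k, rfl⟩ := Nat.exists_eq_add_of_le' hd
      obtain ⟨b, hb, hab⟩ := h.exists_sub_mem hf hz (n := k + 1) (a := a) (l := -(u - f * a))
        (L.neg_mem hau) (by rw [add_right_comm]; convert hun using 1; ring)
      have hbf := mul_mem_degreeBelow hb hf
      have hL : u - b * f ∈ L := by
        convert L.add_mem hau (L.mul_mem_left f hab) using 1; ring
      have := h.homogeneousComponent_mem (k + d) _ hL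
        (Submodule.sub_mem _ hun (by convert hbf using 2; omega))
      rw [map_sub, homogeneousComponent_mul_of_mem_degreeBelow hb hf] at this
      exact mem_sup_span_singleton.mpr ⟨_, by rwa [mul_comm]⟩
  exists_lift := by
    intro n v hv
    obtain ⟨b, hb⟩ := mem_sup_span_singleton.mp hv
    obtain ⟨u, huL, hu, huv⟩ := h.exists_lift n _ hb
    rw [map_sub, mul_comm, homogeneousComponent_mul_of_isHomogeneous _
      (homogeneousComponent_isHomogeneous d f)] at huv
    split_ifs at huv with hd
    · obtain ⟨k, rfl⟩ := Nat.exists_eq_add_of_le' hd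
      rw [Nat.add_sub_cancel] at huv
      have hbk := (homogeneousComponent_isHomogeneous k b).mem_degreeBelow
      refine ⟨u + homogeneousComponent k b * f, mem_sup_span_singleton.mpr
        ⟨homogeneousComponent k b, by simpa [mul_comm f] using huL⟩, Submodule.add_mem _ hu ?_, ?_⟩
      · convert mul_mem_degreeBelow hbk hf using 2; omega
      · rw [map_add, huv, homogeneousComponent_mul_of_mem_degreeBelow hbk hf,
          homogeneousComponent_eq_self (homogeneousComponent_isHomogeneous k b), sub_add_cancel]
    · exact ⟨u, Ideal.mem_sup_left huL, hu, by rw [huv, sub_zero]⟩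

end Filtration

section HilbertSeries

variable {σ K : Type*} [Field K]

/-- The image of the polynomials of degree less than `n` in `MvPolynomial σ K ⧸ L`. -/
noncomputable def quotientDegreeBelow (L : Ideal (MvPolynomial σ K)) (n : ℕ) :
    Submodule K (MvPolynomial σ K ⧸ L) :=
  (degreeBelow σ K n).map (Ideal.Quotient.mkₐ K L).toLinearMap

/-- The generating series of the dimensions of the degree filtration on `MvPolynomial σ K ⧸ L`. -/
noncomputable def hilbertSeries (L : Ideal (MvPolynomial σ K)) : PowerSeries ℤ :=
  PowerSeries.mk fun n => (Module.finrank K (quotientDegreeBelow L n) : ℤ)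

lemma quotientDegreeBelow_mono (L : Ideal (MvPolynomial σ K)) :
    Monotone (quotientDegreeBelow L) :=
  fun _ _ h => Submodule.map_mono (degreeBelow_mono h)

lemma quotientDegreeBelow_zero (L : Ideal (MvPolynomial σ K)) : quotientDegreeBelow L 0 = ⊥ := by
  rw [quotientDegreeBelow, degreeBelow_zero, Submodule.map_bot]

lemma exists_mem_quotientDegreeBelow {L : Ideal (MvPolynomial σ K)} (x : MvPolynomial σ K ⧸ L) :
    ∃ n, x ∈ quotientDegreeBelow L n := by
  obtain ⟨p, rfl⟩ := Ideal.Quotient.mk_surjective x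
  obtain ⟨n, hn⟩ := exists_mem_degreeBelow p
  exact ⟨n, p, hn, rfl⟩

instance [Finite σ] (L : Ideal (MvPolynomial σ K)) (n : ℕ) :
    Module.Finite K (quotientDegreeBelow L n) := by
  unfold quotientDegreeBelow
  infer_instance

variable {L J : Ideal (MvPolynomial σ K)} {d : ℕ} {f : MvPolynomial σ K}

/-- Cutting by `f` changes the filtration by the image of multiplication by `f`. -/
lemma finrank_quotientDegreeBelow_sup [Finite σ] {n : ℕ} (U : Submodule K (MvPolynomial σ K ⧸ L))
    (hU : ∀ x ∈ U, Ideal.Quotient.mk L f * x ∈ quotientDegreeBelow L n)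
    (hinj : ∀ x ∈ U, Ideal.Quotient.mk L f * x = 0 → x = 0)
    (hker : ∀ p ∈ degreeBelow σ K n, p ∈ L ⊔ Ideal.span {f} →
      ∃ x ∈ U, Ideal.Quotient.mk L f * x = Ideal.Quotient.mk L p) :
    Module.finrank K (quotientDegreeBelow L n) =
      Module.finrank K (quotientDegreeBelow (L ⊔ Ideal.span {f}) n) + Module.finrank K U := by
  let π : (MvPolynomial σ K ⧸ L) →ₗ[K] (MvPolynomial σ K ⧸ (L ⊔ Ideal.span {f})) :=
    (Ideal.Quotient.factorₐ K (le_sup_left : L ≤ L ⊔ Ideal.span {f})).toLinearMap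
  have hπ : ∀ p, π (Ideal.Quotient.mk L p) = Ideal.Quotient.mk _ p := fun p => rfl
  let φ := π.domRestrict (quotientDegreeBelow L n)
  have hrange : LinearMap.range φ = quotientDegreeBelow (L ⊔ Ideal.span {f}) n := by
    ext x
    constructor
    · rintro ⟨⟨_, p, hp, rfl⟩, rfl⟩
      exact ⟨p, hp, rfl⟩
    · rintro ⟨p, hp, rfl⟩
      exact ⟨⟨_, p, hp, rfl⟩, rfl⟩
  let ψ : U →ₗ[K] quotientDegreeBelow L n :=
    ((LinearMap.mulLeft K (Ideal.Quotient.mk L f)).domRestrict U).codRestrict _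
      fun x => hU x.1 x.2
  have hψ : ∀ x, (ψ x : MvPolynomial σ K ⧸ L) = Ideal.Quotient.mk L f * x := fun _ => rfl
  have hψinj : Function.Injective ψ := by
    rw [injective_iff_map_eq_zero]
    intro x hx
    exact Subtype.ext (hinj x.1 x.2 (by rw [← hψ, hx]; rfl))
  have hkerφ : LinearMap.ker φ = LinearMap.range ψ := by
    ext ⟨x, p, hp, hpx⟩
    change Ideal.Quotient.mk L p = x at hpx
    subst hpx
    have : (⟨Ideal.Quotient.mk L p, p, hp, rfl⟩ : quotientDegreeBelow L n) ∈ LinearMap.ker φ ↔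
        p ∈ L ⊔ Ideal.span {f} := by
      rw [← Ideal.Quotient.eq_zero_iff_mem]
      rfl
    rw [this]
    constructor
    · intro h
      obtain ⟨x, hx, hxp⟩ := hker p hp h
      exact ⟨⟨x, hx⟩, Subtype.ext hxp⟩
    · rintro ⟨⟨x, hx⟩, hxp⟩
      have hxp' := congrArg Subtype.val hxp
      rw [hψ] at hxp'
      obtain ⟨a, rfl⟩ := Ideal.Quotient.mk_surjective x
      change Ideal.Quotient.mk L f * Ideal.Quotient.mk L a = Ideal.Quotient.mk L p at hxp'
      rw [← map_mul, eq_comm, Ideal.Quotient.eq] at hxp'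
      exact mem_sup_span_singleton.mpr ⟨a, hxp'⟩
  rw [← LinearMap.finrank_range_add_finrank_ker φ, hrange, hkerφ,
    LinearMap.finrank_range_of_inj hψinj]

lemma IsInitialIdeal.hilbertSeries_sup_span_singleton [Finite σ] (h : IsInitialIdeal L J)
    (hf : f ∈ degreeBelow σ K (d + 1)) (hz : NzdMod J (homogeneousComponent d f)) :
    hilbertSeries (L ⊔ Ideal.span {f}) = (1 - PowerSeries.X ^ d) * hilbertSeries L := by
  have hinj : ∀ x : MvPolynomial σ K ⧸ L, Ideal.Quotient.mk L f * x = 0 → x = 0 := by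
    intro x hx
    obtain ⟨a, rfl⟩ := Ideal.Quotient.mk_surjective x
    rw [← map_mul, Ideal.Quotient.eq_zero_iff_mem] at hx
    rw [Ideal.Quotient.eq_zero_iff_mem]
    exact h.mem_of_mul_mem hf hz hx (by simp [mul_comm])
  ext n
  rw [sub_mul, one_mul, map_sub, PowerSeries.coeff_X_pow_mul', eq_sub_iff_add_eq]
  simp only [hilbertSeries, PowerSeries.coeff_mk]
  split_ifs with hd
  · obtain ⟨k, rfl⟩ := Nat.exists_eq_add_of_le' hd
    rw [Nat.add_sub_cancel]
    norm_cast
    refine (finrank_quotientDegreeBelow_sup (f := f) (quotientDegreeBelow L k) ?_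
      (fun x _ => hinj x) ?_).symm
    · rintro _ ⟨p, hp, rfl⟩
      exact ⟨p * f, mul_mem_degreeBelow hp hf, by simp [mul_comm]⟩
    · intro p hp hpf
      obtain ⟨a, ha⟩ := mem_sup_span_singleton.mp hpf
      obtain ⟨b, hb, hab⟩ := h.exists_sub_mem hf hz (n := k) (a := a) (l := -(p - f * a))
        (L.neg_mem ha) (by convert hp using 1; ring)
      refine ⟨_, ⟨b, hb, rfl⟩, ?_⟩
      change Ideal.Quotient.mk L f * Ideal.Quotient.mk L b = _
      rw [← map_mul, eq_comm, Ideal.Quotient.eq]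
      convert L.add_mem ha (L.mul_mem_left f hab) using 1; ring
  · rw [add_zero]
    norm_cast
    have := finrank_quotientDegreeBelow_sup (L := L) (f := f) (n := n) ⊥
      (by rintro x hx; rw [(Submodule.mem_bot K).mp hx, mul_zero]; exact Submodule.zero_mem _)
      (fun x _ => hinj x) (by
        intro p hp hpf
        obtain ⟨a, ha⟩ := mem_sup_span_singleton.mp hpf
        have haL := h.mem_of_mul_mem hf hz (a := a) (l := -(p - f * a)) (L.neg_mem ha)
          (by convert degreeBelow_mono (by omega : n ≤ d) hp using 1; ring)
        refine ⟨0, Submodule.zero_mem _, ?_⟩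
        rw [mul_zero, eq_comm, Ideal.Quotient.eq_zero_iff_mem]
        simpa using L.add_mem ha (L.mul_mem_left f haL))
    rw [this, finrank_bot, add_zero]

end HilbertSeries

section CompleteIntersection

variable {σ K : Type*} [Field K]

lemma Ideal.sup_span_singleton_sum_erase {R ι : Type*} [CommRing R] [DecidableEq ι] (J : Ideal R)
    (g a : ι → R) {s : Finset ι} {i₀ : ι} (hi₀ : i₀ ∈ s) (ha : a i₀ = 1) :
    J ⊔ Ideal.span {∑ i ∈ s, a i * g i} ⊔ Ideal.span (g '' (s.erase i₀ : Finset ι)) =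
      J ⊔ Ideal.span (g '' s) := by
  rw [sup_assoc]
  congr 1
  have hsum := Finset.add_sum_erase s (fun i => a i * g i) hi₀
  rw [ha, one_mul] at hsum
  apply le_antisymm
  · refine sup_le ?_ (Ideal.span_mono (Set.image_mono (by simp)))
    rw [Ideal.span_singleton_le_iff_mem]
    exact Ideal.sum_mem _ fun i hi => Ideal.mul_mem_left _ _
      (Ideal.subset_span (Set.mem_image_of_mem g hi))
  · have herase : ∀ i ∈ s.erase i₀, g i ∈ Ideal.span (g '' (s.erase i₀ : Finset ι)) :=
      fun i hi => Ideal.subset_span (Set.mem_image_of_mem g hi)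
    rw [Ideal.span_le]
    rintro _ ⟨i, hi, rfl⟩
    by_cases hii : i = i₀
    · subst hii
      rw [eq_sub_of_add_eq hsum]
      exact Ideal.sub_mem _ (Ideal.mem_sup_left (Ideal.mem_span_singleton_self _))
        (Ideal.mem_sup_right (Ideal.sum_mem _ fun j hj => Ideal.mul_mem_left _ _ (herase j hj)))
    · exact Ideal.mem_sup_right (herase i (Finset.mem_erase.mpr ⟨hii, hi⟩))

lemma NzdMod.mem_of_pow_mul_mem {R : Type*} [CommRing R] {J : Ideal R} {w : R} (hw : NzdMod J w)
    (n : ℕ) {u : R} (hu : w ^ n * u ∈ J) : u ∈ J := by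
  induction n with
  | zero => simpa using hu
  | succ n ih => exact ih (hw _ (by rwa [← mul_assoc, ← pow_succ']))

/-- A generic combination of forms `g i`, homogeneous of the largest degree involved, is a
non-zero-divisor modulo `J` provided the `g i` cut out the origin modulo `J`. -/
lemma exists_nzdMod_sum [Finite σ] [Infinite K] {ι : Type*} (s : Finset ι)
    (g : ι → MvPolynomial σ K) (d : ι → ℕ) {i₀ : ι} (hi₀ : i₀ ∈ s)
    {J : Ideal (MvPolynomial σ K)} {w : MvPolynomial σ K}
    (hwP : w ∈ Ideal.span (Set.range X)) (hw : NzdMod J w)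
    (hrad : Ideal.span (Set.range X) ≤ (J ⊔ Ideal.span (g '' s)).radical) :
    ∃ a : ι → MvPolynomial σ K, (∀ i ∈ s, (a i).IsHomogeneous (d i₀ - d i)) ∧ a i₀ = 1 ∧
      NzdMod J (∑ i ∈ s, a i * g i) := by
  classical
  obtain ⟨S, hfin, hprime, hann, hnzd⟩ := exists_finite_primes_of_nzdMod J
  let V : Submodule K (ι → MvPolynomial σ K) :=
    Submodule.pi s fun i => homogeneousSubmodule σ K (d i₀ - d i)
  let T : V →ₗ[K] MvPolynomial σ K :=
    (∑ i ∈ s, (LinearMap.mulRight K (g i)) ∘ₗ LinearMap.proj i) ∘ₗ V.subtype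
  have hT : ∀ a : V, T a = ∑ i ∈ s, a.1 i * g i := fun a => by simp [T]
  have hsingle : ∀ i, ∀ p : MvPolynomial σ K, p.IsHomogeneous (d i₀ - d i) →
      Pi.single i p ∈ V := by
    intro i p hp j _
    by_cases hij : j = i
    · subst hij; simpa using hp
    · simp [hij]
  have := hfin.to_subtype
  let W : Option S → Subspace K V
    | none => LinearMap.ker (LinearMap.proj i₀ ∘ₗ V.subtype)
    | some Q => (Q.1.restrictScalars K).comap T
  have hW : ∀ o, W o ≠ ⊤ := by
    rintro (_ | ⟨Q, hQ⟩) htop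
    · have : (⟨_, hsingle i₀ 1 (by simpa using isHomogeneous_one σ K)⟩ : V) ∈ W none :=
        htop ▸ Submodule.mem_top
      simp [W] at this
    · have := hprime Q hQ
      obtain ⟨u, hu, hQu⟩ := hann Q hQ
      have hg : ∀ i ∈ s, g i ∈ Q := by
        intro i hi
        by_contra hgi
        have hX : ∀ x, X x ∈ Q := by
          intro x
          have hmem : (⟨_, hsingle i (X x ^ (d i₀ - d i))
            (by simpa using (isHomogeneous_X K x).pow (d i₀ - d i))⟩ : V) ∈ W (some ⟨Q, hQ⟩) :=
            htop ▸ Submodule.mem_top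
          have hmem' : X x ^ (d i₀ - d i) * g i ∈ Q := by
            have h' : T _ ∈ Q := hmem
            rw [hT, Finset.sum_eq_single_of_mem i hi] at h'
            · simpa using h'
            · intro j _ hj
              simp [hj]
          exact this.mem_of_pow_mem _ ((this.mem_or_mem hmem').resolve_right hgi)
        have hPQ : Ideal.span (Set.range X) ≤ Q := by
          rw [Ideal.span_le]
          rintro _ ⟨x, rfl⟩
          exact hX x
        exact hu (hw u (hQu w (hPQ hwP)))
      have hgQ : Ideal.span (g '' s) ≤ Q := by
        rw [Ideal.span_le]
        rintro _ ⟨i, hi, rfl⟩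
        exact hg i hi
      obtain ⟨N, hN⟩ := hrad hwP
      obtain ⟨j, hj, q, hq, hjq⟩ := Submodule.mem_sup.mp hN
      refine hu (hw.mem_of_pow_mul_mem N ?_)
      rw [← hjq, add_mul]
      exact J.add_mem (J.mul_mem_right _ hj) (hQu q (hgQ hq))
  have hcover : ⋃ o, (W o : Set V) ≠ Set.univ := fun h => by
    obtain ⟨o, ho⟩ := Subspace.exists_eq_top_of_iUnion_eq_univ h
    exact hW o ho
  obtain ⟨a, ha⟩ := (Set.ne_univ_iff_exists_notMem _).mp hcover
  simp only [Set.mem_iUnion, not_exists, SetLike.mem_coe] at ha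
  have ha0 : a.1 i₀ ≠ 0 := fun h => ha none h
  have hahom : ∀ i ∈ s, (a.1 i).IsHomogeneous (d i₀ - d i) := fun i hi => a.2 i hi
  obtain ⟨c, hc⟩ : ∃ c, a.1 i₀ = C c := by
    have := (hahom i₀ hi₀).totalDegree_le
    rw [Nat.sub_self, Nat.le_zero] at this
    exact ⟨_, totalDegree_eq_zero_iff_eq_C.mp this⟩
  have hc0 : c ≠ 0 := by
    rintro rfl
    exact ha0 (by rw [hc, map_zero])
  refine ⟨fun i => C c⁻¹ * a.1 i, fun i hi => ?_, ?_, hnzd _ fun Q hQ hmem => ?_⟩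
  · simpa using (isHomogeneous_C σ c⁻¹).mul (hahom i hi)
  · beta_reduce
    rw [hc, ← C_mul, inv_mul_cancel₀ hc0, C_1]
  · refine ha (some ⟨Q, hQ⟩) ?_
    change T a ∈ Q
    rw [hT]
    simp_rw [mul_assoc, ← Finset.mul_sum] at hmem
    have := Q.mul_mem_left (C c) hmem
    rwa [← mul_assoc, ← C_mul, mul_inv_cancel₀ hc0, C_1, one_mul] at this

lemma MvPolynomial.IsHomogeneous.mem_span_range_X {n : ℕ} (hn : 1 ≤ n) {p : MvPolynomial σ K}
    (hp : p.IsHomogeneous n) : p ∈ Ideal.span (Set.range X) := by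
  rw [← Set.image_univ, mem_ideal_span_X_image]
  intro s hs
  by_contra! h
  have hs0 : s = 0 := Finsupp.ext fun i => h i (Set.mem_univ i)
  have := hp (mem_support_iff.mp hs)
  rw [hs0, map_zero] at this
  omega

/-- Cutting by polynomials `f i` of degree `d i` whose leading forms cut out the origin modulo `J`
multiplies the Hilbert series by `∏ i ∈ s, (1 - X ^ d i)`. -/
theorem hilbertSeries_sup_span [Finite σ] [Infinite K] {ι : Type*} (f : ι → MvPolynomial σ K)
    (d : ι → ℕ) (hd : ∀ i, 1 ≤ d i) (hf : ∀ i, f i ∈ degreeBelow σ K (d i + 1)) (s : Finset ι)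
    {L J : Ideal (MvPolynomial σ K)} (hLJ : IsInitialIdeal L J)
    (hdepth : HasDepth (Ideal.span (Set.range X)) s.card J)
    (hrad : Ideal.span (Set.range X) ≤
      (J ⊔ Ideal.span ((fun i => homogeneousComponent (d i) (f i)) '' s)).radical) :
    hilbertSeries (L ⊔ Ideal.span (f '' s)) =
      (∏ i ∈ s, (1 - PowerSeries.X ^ d i)) * hilbertSeries L := by
  classical
  induction hn : s.card generalizing s L J with
  | zero =>
    rw [Finset.card_eq_zero] at hn
    subst hn
    simp
  | succ n ih =>
    obtain ⟨i₀, hi₀, hmax⟩ := s.exists_max_image d (Finset.card_pos.mp (by omega))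
    rw [hn] at hdepth
    obtain ⟨w, hwP, hw, -⟩ := id hdepth
    obtain ⟨a, ha, ha1, hz⟩ := exists_nzdMod_sum s _ d hi₀ hwP hw hrad
    have hmem : ∀ i ∈ s, a i * f i ∈ degreeBelow σ K (d i₀ + 1) := by
      intro i hi
      convert mul_mem_degreeBelow (ha i hi).mem_degreeBelow (hf i) using 2
      have := hmax i hi
      omega
    have hcomp : homogeneousComponent (d i₀) (∑ i ∈ s, a i * f i) =
        ∑ i ∈ s, a i * homogeneousComponent (d i) (f i) := by
      rw [map_sum]
      refine Finset.sum_congr rfl fun i hi => ?_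
      have := homogeneousComponent_mul_of_mem_degreeBelow (ha i hi).mem_degreeBelow (hf i)
      rwa [Nat.sub_add_cancel (hmax i hi), homogeneousComponent_eq_self (ha i hi)] at this
    have hzd := Submodule.sum_mem _ hmem
    rw [← hcomp] at hz
    have hzP := (homogeneousComponent_isHomogeneous (d i₀)
      (∑ i ∈ s, a i * f i)).mem_span_range_X (hd i₀)
    have hcard : (s.erase i₀).card = n := by rw [Finset.card_erase_of_mem hi₀, hn]; rfl
    have key := ih (s.erase i₀) (hLJ.sup_span_singleton hzd hz)
      (by rw [hcard]; exact hdepth.sup_span_singleton n hzP hz)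
      (by rw [hcomp, Ideal.sup_span_singleton_sum_erase J _ a hi₀ ha1]; exact hrad) hcard
    rw [Ideal.sup_span_singleton_sum_erase L f a hi₀ ha1,
      hLJ.hilbertSeries_sup_span_singleton hzd hz, ← mul_assoc,
      Finset.prod_erase_mul s _ hi₀] at key
    exact key

lemma nzdMod_span_X_image {t : Set σ} {k : σ} (hk : k ∉ t) :
    NzdMod (Ideal.span (X '' t : Set (MvPolynomial σ K))) (X k) := by
  classical
  intro a ha
  rw [mem_ideal_span_X_image] at ha ⊢
  intro s hs
  obtain ⟨i, hi, hsi⟩ := ha (Finsupp.single k 1 + s) (by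
    rw [mem_support_iff, coeff_X_mul]
    exact mem_support_iff.mp hs)
  refine ⟨i, hi, ?_⟩
  have hki : k ≠ i := fun h => hk (h ▸ hi)
  simpa [Finsupp.single_eq_of_ne hki.symm] using hsi

lemma hasDepth_span_range_X [Fintype σ] :
    HasDepth (Ideal.span (Set.range X)) (Fintype.card σ) (⊥ : Ideal (MvPolynomial σ K)) := by
  classical
  suffices H : ∀ t : Finset σ, HasDepth (Ideal.span (Set.range X)) t.card
      (Ideal.span (X '' (t : Set σ)ᶜ : Set (MvPolynomial σ K))) by
    simpa using H Finset.univ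
  intro t
  induction t using Finset.induction_on with
  | empty => trivial
  | insert k t hk ih =>
    rw [Finset.card_insert_of_notMem hk]
    refine ⟨X k, Ideal.subset_span ⟨k, rfl⟩, nzdMod_span_X_image (by simp), ?_⟩
    convert ih using 1
    rw [← Ideal.span_union]
    congr 1
    rw [← Set.image_singleton, ← Set.image_union]
    congr 1
    ext x
    by_cases hx : x = k
    · subst hx; simpa using hk
    · simp [hx]

lemma hilbertSeries_span_range_X :
    (1 - PowerSeries.X) * hilbertSeries (Ideal.span (Set.range X) : Ideal (MvPolynomial σ K)) =
      PowerSeries.X := by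
  set P : Ideal (MvPolynomial σ K) := Ideal.span (Set.range X) with hP
  have h1 : (1 : MvPolynomial σ K ⧸ P) ≠ 0 := by
    rw [← map_one (Ideal.Quotient.mk P), Ne, Ideal.Quotient.eq_zero_iff_mem, hP,
      ← Set.image_univ, mem_ideal_span_X_image]
    intro h
    obtain ⟨i, -, hi⟩ := h 0 (by simp)
    exact hi rfl
  have hsucc : ∀ n, quotientDegreeBelow P (n + 1) = Submodule.span K {1} := by
    intro n
    apply le_antisymm
    · rintro _ ⟨p, -, rfl⟩
      rw [Submodule.mem_span_singleton]
      refine ⟨coeff 0 p, ?_⟩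
      change _ = Ideal.Quotient.mk P p
      rw [← map_one (Ideal.Quotient.mk P), ← Ideal.Quotient.mkₐ_eq_mk K, ← map_smul,
        Ideal.Quotient.mkₐ_eq_mk, eq_comm, Ideal.Quotient.eq, hP, ← Set.image_univ,
        mem_ideal_span_X_image]
      intro s hs
      by_contra! h
      have hs0 : s = 0 := Finsupp.ext fun i => h i (Set.mem_univ i)
      subst hs0
      simp at hs
    · rw [Submodule.span_singleton_le_iff_mem]
      exact ⟨1, degreeBelow_mono (by omega) (isHomogeneous_one σ K).mem_degreeBelow, map_one (Ideal.Quotient.mk P)⟩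
  have hs : hilbertSeries P = PowerSeries.X * PowerSeries.mk 1 := by
    ext n
    cases n with
    | zero =>
      simp only [hilbertSeries, PowerSeries.coeff_mk]
      rw [quotientDegreeBelow_zero]
      simp
    | succ n =>
      simp only [hilbertSeries, PowerSeries.coeff_mk, PowerSeries.coeff_succ_X_mul]
      rw [hsucc, finrank_span_singleton h1]
      simp
  rw [hs, mul_left_comm, mul_comm (1 - PowerSeries.X), PowerSeries.mk_one_mul_one_sub_eq_one,
    mul_one]

/-- If `(1 - X) * hilbertSeries L` is `X` times a polynomial `G`, then the quotient by `L` is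
finite-dimensional of dimension `G(1)`. -/
lemma finrank_quotient_of_hilbertSeries [Finite σ] {L : Ideal (MvPolynomial σ K)}
    (G : Polynomial ℤ)
    (h : (1 - PowerSeries.X) * hilbertSeries L = PowerSeries.X * (G : PowerSeries ℤ)) :
    Module.Finite K (MvPolynomial σ K ⧸ L) ∧
      (Module.finrank K (MvPolynomial σ K ⧸ L) : ℤ) = G.eval 1 := by
  have hsum : ∀ n, (Module.finrank K (quotientDegreeBelow L n) : ℤ) =
      ∑ j ∈ Finset.range n, G.coeff j := by
    intro n
    induction n with
    | zero => simp [quotientDegreeBelow_zero]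
    | succ n ih =>
      have := congrArg (PowerSeries.coeff (n + 1)) h
      rw [sub_mul, one_mul, map_sub, PowerSeries.coeff_succ_X_mul, PowerSeries.coeff_succ_X_mul,
        Polynomial.coeff_coe] at this
      simp only [hilbertSeries, PowerSeries.coeff_mk] at this
      rw [Finset.sum_range_succ, ← ih]
      linarith
  have hlarge : ∀ n, G.natDegree < n →
      (Module.finrank K (quotientDegreeBelow L n) : ℤ) = G.eval 1 := by
    intro n hn
    rw [hsum, Polynomial.eval_eq_sum_range' hn]
    simp
  have htop : quotientDegreeBelow L (G.natDegree + 1) = ⊤ := by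
    rw [eq_top_iff]
    intro x _
    obtain ⟨n, hn⟩ := exists_mem_quotientDegreeBelow x
    have hle := quotientDegreeBelow_mono L (le_max_right n (G.natDegree + 1))
    rw [Submodule.eq_of_le_of_finrank_eq hle
      (by exact_mod_cast (hlarge _ (by omega)).trans (hlarge _ (by omega)).symm)]
    exact quotientDegreeBelow_mono L (le_max_left _ _) hn
  have hfin : Module.Finite K (⊤ : Submodule K (MvPolynomial σ K ⧸ L)) := by
    rw [← htop]
    infer_instance
  refine ⟨Module.finite_def.mpr (Module.Finite.iff_fg.mp hfin), ?_⟩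
  rw [← finrank_top, ← htop]
  exact hlarge _ (Nat.lt_succ_self _)

lemma span_range_X_le_radical [IsAlgClosed K] [Finite σ] (I : Ideal (MvPolynomial σ K))
    (h : ∀ x : σ → K, (∀ p ∈ I, eval x p = 0) → x = 0) :
    Ideal.span (Set.range X) ≤ I.radical := by
  rw [Ideal.span_le]
  rintro _ ⟨i, rfl⟩
  rw [SetLike.mem_coe, ← vanishingIdeal_zeroLocus_eq_radical (K := K), mem_vanishingIdeal_iff]
  intro x hx
  rw [h x fun p hp => by simpa [aeval_eq_eval] using hx p hp]
  simp

end CompleteIntersection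

/-- Let `K` be an algebraically closed field and
`f₁, …, f_m ∈ K[x₁, …, x_m]` with total degrees `d₁, …, d_m ≥ 1`.  Assume that
the leading forms of the `fᵢ` (their homogeneous components of degrees `dᵢ`)
have no common zero in `Kᵐ` other than the origin.  Then the quotient algebra
`A = K[x₁, …, x_m]/⟨f₁, …, f_m⟩` is a finite-dimensional `K`-vector space of
dimension exactly `∏ i, dᵢ`. -/
theorem stmt1 {K : Type*} [Field K] [IsAlgClosed K] (m : ℕ)
    (f : Fin m → MvPolynomial (Fin m) K) (dd : Fin m → ℕ)
    (hd : ∀ i, 1 ≤ dd i)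
    (hdeg : ∀ i, (f i).totalDegree = dd i)
    (hlead : ∀ x : Fin m → K,
      (∀ i, eval x (homogeneousComponent (dd i) (f i)) = 0) → x = 0) :
    FiniteDimensional K (MvPolynomial (Fin m) K ⧸ Ideal.span (Set.range f)) ∧
      Module.finrank K (MvPolynomial (Fin m) K ⧸ Ideal.span (Set.range f))
        = ∏ i, dd i := by
  have := IsAlgClosed.instInfinite (K := K)
  have hdepth : HasDepth (Ideal.span (Set.range X)) (Finset.univ : Finset (Fin m)).card
      (⊥ : Ideal (MvPolynomial (Fin m) K)) := hasDepth_span_range_X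
  have hHf := hilbertSeries_sup_span f dd hd
    (fun i => mem_degreeBelow_succ_iff.mpr (hdeg i).le) Finset.univ isInitialIdeal_bot hdepth
    (span_range_X_le_radical _ fun x hx => hlead x fun i => hx _
      (Ideal.mem_sup_right (Ideal.subset_span ⟨i, by simp, rfl⟩)))
  have hHX := hilbertSeries_sup_span (X : Fin m → MvPolynomial (Fin m) K) (fun _ => 1)
    (fun _ => le_rfl) (fun i => (isHomogeneous_X K i).mem_degreeBelow) Finset.univ
    isInitialIdeal_bot hdepth (by
      simp_rw [homogeneousComponent_eq_self (isHomogeneous_X K _)]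
      simpa using Ideal.le_radical)
  simp only [Finset.coe_univ, Set.image_univ, bot_sup_eq, pow_one] at hHf hHX
  have hne : (1 - PowerSeries.X : PowerSeries ℤ) ≠ 0 := fun h => by
    simpa using congrArg PowerSeries.constantCoeff h
  have hgeom : ∏ i, (1 - PowerSeries.X ^ dd i : PowerSeries ℤ) =
      (∏ i, ∑ j ∈ Finset.range (dd i), PowerSeries.X ^ j) *
        ∏ _i : Fin m, (1 - PowerSeries.X) := by
    rw [← Finset.prod_mul_distrib]
    exact Finset.prod_congr rfl fun i _ => (geom_sum_mul_neg _ _).symm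
  obtain ⟨hfin, hrank⟩ := finrank_quotient_of_hilbertSeries (L := Ideal.span (Set.range f))
    (∏ i, ∑ j ∈ Finset.range (dd i), Polynomial.X ^ j) (by
      have hG : ((∏ i, ∑ j ∈ Finset.range (dd i), Polynomial.X ^ j : Polynomial ℤ) :
          PowerSeries ℤ) = ∏ i, ∑ j ∈ Finset.range (dd i), PowerSeries.X ^ j := by
        rw [← Polynomial.coeToPowerSeries.ringHom_apply]
        simp [map_prod, map_sum]
      rw [hG, hHf, hgeom, mul_assoc, ← hHX, mul_left_comm, hilbertSeries_span_range_X, mul_comm])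
  refine ⟨hfin, ?_⟩
  rw [Polynomial.eval_prod] at hrank
  simp only [Polynomial.eval_finsetSum, Polynomial.eval_pow, Polynomial.eval_X, one_pow,
    Finset.sum_const, Finset.card_range, nsmul_eq_mul, mul_one] at hrank
  exact_mod_cast hrank
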